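/- Let F be a field of characteristic 0, let V be an F-vector space of finite even dimension k, and let Q be a nondegenerate quadratic form on V. Then the Clifford algebra C(Q) is a central simple F-algebra, and every simple C(Q)-module L satisfies dim_F L ≥ 2^{k/2}. -/

import Mathlib

open QuadraticMap

section Aux

variable {F A : Type*} [Field F] [Ring A] [Algebra F A] {k : ℕ}

/-- commutation sign of the generators `i`, `j` -/
def cSgn (F : Type*) [Field F] {k : ℕ} (i j : Fin k) : F := if i = j then 1 else -1

/-- commutation character of a subset -/
def cChi (F : Type*) [Field F] {k : ℕ} (S : Finset (Fin k)) (i : Fin k) : F :=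
  ∏ j ∈ S, cSgn F i j

/-- monomial of a subset -/
noncomputable def cMono (e : Fin k → A) (S : Finset (Fin k)) : A := (S.toList.map e).prod

/-- projector factor -/
noncomputable def cProj (e : Fin k → A) (a : Fin k → F) (S : Finset (Fin k)) (i : Fin k) :
    A →ₗ[F] A :=
  (2⁻¹ : F) • (LinearMap.id + (cChi F S i * (a i)⁻¹) • LinearMap.mulLeftRight F (e i, e i))

/-- projector -/
noncomputable def cP (e : Fin k → A) (a : Fin k → F) (S : Finset (Fin k)) : Module.End F A :=
  ((List.finRange k).map (cProj e a S)).prod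

lemma cProj_apply (e : Fin k → A) (a : Fin k → F) (S : Finset (Fin k)) (i : Fin k) (x : A) :
    cProj e a S i x = (2⁻¹ : F) • (x + (cChi F S i * (a i)⁻¹) • (e i * x * e i)) := by
  simp [cProj]

lemma cChi_sq (S : Finset (Fin k)) (i : Fin k) : cChi F S i * cChi F S i = 1 := by
  unfold cChi
  rw [← Finset.prod_mul_distrib]
  apply Finset.prod_eq_one
  intro j _
  unfold cSgn
  split_ifs <;> simp

lemma prod_cChi (hk : Even k) (S : Finset (Fin k)) : ∏ i, cChi F S i = (-1) ^ S.card := by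
  unfold cChi
  rw [Finset.prod_comm, Finset.prod_eq_pow_card]
  intro j _
  have h : ∀ i : Fin k, cSgn F i j = (-1) * (if i = j then -1 else 1) := by
    intro i; unfold cSgn; split_ifs <;> simp
  simp only [h, Finset.prod_mul_distrib, Finset.prod_const, Finset.card_univ, Fintype.card_fin,
    hk.neg_one_pow, one_mul, Finset.prod_ite_eq', Finset.mem_univ, if_true]

lemma cChi_eq (S : Finset (Fin k)) (i : Fin k) :
    cChi F S i = (-1) ^ S.card * (if i ∈ S then -1 else 1) := by
  unfold cChi
  have h : ∀ j : Fin k, cSgn F i j = (-1) * (if i = j then -1 else 1) := by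
    intro i; unfold cSgn; split_ifs <;> simp
  simp only [h, Finset.prod_mul_distrib, Finset.prod_const, Finset.prod_ite_eq]

lemma cChi_inj [CharZero F] (hk : Even k) {S T : Finset (Fin k)}
    (h : ∀ i, cChi F S i = cChi F T i) : S = T := by
  have h1 : (-1 : F) ^ S.card = (-1) ^ T.card := by
    rw [← prod_cChi hk, ← prod_cChi hk]; simp [h]
  ext i
  have h2 := h i
  rw [cChi_eq, cChi_eq, h1] at h2
  have h3 : (-1 : F) ^ T.card ≠ 0 := by simp
  have h4 := mul_left_cancel₀ h3 h2
  have h5 : (-1 : F) ≠ 1 := by norm_num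
  by_cases hS : i ∈ S <;> by_cases hT : i ∈ T <;> simp [hS, hT, h5, h5.symm] at h4 ⊢

variable {e : Fin k → A} {a : Fin k → F}

lemma e_mul_list (hc : ∀ i j, i ≠ j → e i * e j = - (e j * e i)) (i : Fin k) (l : List (Fin k)) :
    e i * (l.map e).prod = (l.map (cSgn F i)).prod • ((l.map e).prod * e i) := by
  induction l with
  | nil => simp
  | cons j l ih =>
    have h : e i * e j = cSgn F i j • (e j * e i) := by
      unfold cSgn
      split_ifs with h
      · simp [h]
      · simp [hc i j h]
    simp only [List.map_cons, List.prod_cons]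
    rw [← mul_assoc, h, smul_mul_assoc, mul_assoc, ih, mul_smul_comm, smul_smul, mul_assoc]

lemma e_mul_mono (hc : ∀ i j, i ≠ j → e i * e j = - (e j * e i)) (i : Fin k)
    (S : Finset (Fin k)) :
    e i * cMono e S = cChi F S i • (cMono e S * e i) := by
  unfold cMono
  rw [e_mul_list (F := F) hc, Finset.prod_map_toList]; rfl

lemma e_mono_e (ha : ∀ i, e i * e i = algebraMap F A (a i))
    (hc : ∀ i j, i ≠ j → e i * e j = - (e j * e i)) (i : Fin k)
    (S : Finset (Fin k)) :
    e i * cMono e S * e i = (cChi F S i * a i) • cMono e S := by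
  rw [e_mul_mono (F := F) hc, smul_mul_assoc, mul_assoc, ha, ← Algebra.commutes,
    ← Algebra.smul_def, smul_smul]

lemma cProj_mono [CharZero F] (ha0 : ∀ i, a i ≠ 0) (ha : ∀ i, e i * e i = algebraMap F A (a i))
    (hc : ∀ i j, i ≠ j → e i * e j = - (e j * e i)) (S T : Finset (Fin k)) (i : Fin k) :
    cProj e a S i (cMono e T) = (2⁻¹ * (1 + cChi F S i * cChi F T i)) • cMono e T := by
  rw [cProj_apply, e_mono_e ha hc, smul_smul]
  have : cChi F S i * (a i)⁻¹ * (cChi F T i * a i) = cChi F S i * cChi F T i := by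
    field_simp [ha0 i]
  rw [this, mul_smul (2⁻¹ : F), add_smul, one_smul]

lemma cP_mono [CharZero F] (hk : Even k) (ha0 : ∀ i, a i ≠ 0)
    (ha : ∀ i, e i * e i = algebraMap F A (a i))
    (hc : ∀ i j, i ≠ j → e i * e j = - (e j * e i)) (S T : Finset (Fin k)) :
    cP e a S (cMono e T) = if S = T then cMono e T else 0 := by
  have key : ∀ l : List (Fin k), (l.map (cProj e a S) : List (Module.End F A)).prod (cMono e T)
      = (l.map (fun i => 2⁻¹ * (1 + cChi F S i * cChi F T i))).prod • cMono e T := by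
    intro l
    induction l with
    | nil => simp
    | cons j l ih =>
      simp only [List.map_cons, List.prod_cons, Module.End.mul_apply]
      rw [ih, map_smul, cProj_mono ha0 ha hc, smul_smul, mul_comm]
  unfold cP
  rw [key]
  split_ifs with h
  · subst h
    simp only [cChi_sq]
    norm_num
  · have : ∃ i, cChi F S i ≠ cChi F T i := by
      by_contra! h'
      exact h (cChi_inj hk h')
    obtain ⟨i, hi⟩ := this
    have h0 : cChi F S i * cChi F T i = -1 := by
      have h1 := cChi_sq (F := F) S i
      have h2 := cChi_sq (F := F) T i
      rcases mul_self_eq_one_iff.1 h1 with h1 | h1 <;>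
        rcases mul_self_eq_one_iff.1 h2 with h2 | h2 <;> simp_all
    rw [List.prod_eq_zero, zero_smul]
    simp only [List.mem_map, List.mem_finRange, true_and]
    exact ⟨i, by rw [h0]; simp⟩

lemma cP_sum [CharZero F] (hk : Even k) (ha0 : ∀ i, a i ≠ 0)
    (ha : ∀ i, e i * e i = algebraMap F A (a i))
    (hc : ∀ i j, i ≠ j → e i * e j = - (e j * e i)) (S : Finset (Fin k))
    (c : Finset (Fin k) → F) :
    cP e a S (∑ T, c T • cMono e T) = c S • cMono e S := by
  simp [map_sum, cP_mono hk ha0 ha hc]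

lemma isUnit_mono (ha0 : ∀ i, a i ≠ 0) (ha : ∀ i, e i * e i = algebraMap F A (a i))
    (S : Finset (Fin k)) : IsUnit (cMono e S) := by
  have h : ∀ i, IsUnit (e i) := fun i => by
    have : IsUnit (e i * e i) := by rw [ha]; exact (ha0 i).isUnit.map _
    exact ((Commute.refl (e i)).isUnit_mul_iff.1 this).1
  unfold cMono
  generalize S.toList = l
  induction l with
  | nil => simp
  | cons j l ih => simpa using (h j).mul ih

lemma perm_mono (hc : ∀ i j, i ≠ j → e i * e j = - (e j * e i)) {l l' : List (Fin k)}
    (h : l.Perm l') : (l.map e).prod ∈ Submodule.span F {(l'.map e).prod} := by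
  induction h with
  | nil => exact Submodule.mem_span_singleton_self _
  | cons x _ ih =>
    obtain ⟨c, hc⟩ := Submodule.mem_span_singleton.1 ih
    refine Submodule.mem_span_singleton.2 ⟨c, ?_⟩
    simp [← hc]
  | swap x y l =>
    by_cases hxy : y = x
    · subst hxy; exact Submodule.mem_span_singleton_self _
    · refine Submodule.mem_span_singleton.2 ⟨-1, ?_⟩
      simp [← mul_assoc, hc y x hxy]
  | trans _ _ h1 h2 =>
    refine Submodule.span_le.2 ?_ h1
    simpa using h2

lemma e_mul_mono_mem (ha : ∀ i, e i * e i = algebraMap F A (a i))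
    (hc : ∀ i j, i ≠ j → e i * e j = - (e j * e i)) (i : Fin k) (S : Finset (Fin k)) :
    e i * cMono e S ∈ Submodule.span F (Set.range (cMono e)) := by
  by_cases h : i ∈ S
  · have h1 : S.toList.Perm (i :: (S.erase i).toList) := by
      conv_lhs => rw [← Finset.insert_erase h]
      exact Finset.toList_insert (Finset.notMem_erase i S)
    obtain ⟨c, hc⟩ := Submodule.mem_span_singleton.1 (perm_mono (F := F) hc h1)
    have : e i * cMono e S = (c * a i) • cMono e (S.erase i) := by
      unfold cMono
      rw [← hc, List.map_cons, List.prod_cons, mul_smul_comm, ← mul_assoc, ha,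
        ← Algebra.smul_def, smul_smul]
    rw [this]
    exact Submodule.smul_mem _ _ (Submodule.subset_span ⟨_, rfl⟩)
  · have h1 := (Finset.toList_insert h).symm
    obtain ⟨c, hc⟩ := Submodule.mem_span_singleton.1 (perm_mono (F := F) hc h1)
    have : e i * cMono e S = c • cMono e (insert i S) := by
      unfold cMono
      rw [hc, List.map_cons, List.prod_cons]
    rw [this]
    exact Submodule.smul_mem _ _ (Submodule.subset_span ⟨_, rfl⟩)

lemma cliff_main [CharZero F] [Nontrivial A] (hk : Even k) (ha0 : ∀ i, a i ≠ 0)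
    (ha : ∀ i, e i * e i = algebraMap F A (a i))
    (hc : ∀ i j, i ≠ j → e i * e j = - (e j * e i))
    (hs : Submodule.span F (Set.range (cMono e)) = ⊤) :
    Subalgebra.center F A = ⊥ ∧ IsSimpleRing A ∧ Module.finrank F A = 2 ^ k ∧
      Module.Finite F A := by
  have hx : ∀ x : A, ∃ c : Finset (Fin k) → F, ∑ T, c T • cMono e T = x := fun x =>
    (Submodule.mem_span_range_iff_exists_fun F).1 (hs ▸ Submodule.mem_top)
  have hli : LinearIndependent F (cMono e) := by
    rw [Fintype.linearIndependent_iff]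
    intro c h0 S
    have := cP_sum hk ha0 ha hc S c
    rw [h0, map_zero] at this
    exact (smul_eq_zero.1 this.symm).resolve_right (isUnit_mono ha0 ha S).ne_zero
  let b := Module.Basis.mk hli hs.ge
  refine ⟨?_, ?_, ?_, Module.Finite.of_basis b⟩
  · rw [eq_bot_iff]
    intro x hxc
    rw [Subalgebra.mem_center_iff] at hxc
    have hfix : cP e a ∅ x = x := by
      unfold cP
      generalize List.finRange k = l
      induction l with
      | nil => simp
      | cons j l ih =>
        simp only [List.map_cons, List.prod_cons, Module.End.mul_apply]
        rw [ih, cProj_apply, hxc, mul_assoc, ha, ← Algebra.commutes, ← Algebra.smul_def, smul_smul]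
        have : cChi F ∅ j * (a j)⁻¹ * a j = 1 := by simp [cChi, ha0 j]
        rw [this, one_smul, ← two_smul F, smul_smul]
        simp
    obtain ⟨c, rfl⟩ := hx x
    rw [cP_sum hk ha0 ha hc] at hfix
    rw [← hfix]
    refine Subalgebra.smul_mem _ ?_ _
    simp [cMono]
  · refine IsSimpleRing.of_eq_bot_or_eq_top fun I => ?_
    rw [or_iff_not_imp_left, ← I.one_mem_iff]
    intro H
    obtain ⟨x, hx1, hx2⟩ := SetLike.exists_of_lt (bot_lt_iff_ne_bot.mpr H : ⊥ < I)
    replace hx2 : x ≠ 0 := hx2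
    have hsm : ∀ (r : F) (y : A), y ∈ I → r • y ∈ I := fun r y hy => by
      rw [Algebra.smul_def]; exact I.mul_mem_left _ _ hy
    have hP : ∀ S, cP e a S x ∈ I := by
      intro S
      unfold cP
      generalize List.finRange k = l
      induction l with
      | nil => simpa
      | cons j l ih =>
        simp only [List.map_cons, List.prod_cons, Module.End.mul_apply]
        rw [cProj_apply]
        exact hsm _ _ (I.add_mem ih (hsm _ _ (I.mul_mem_right _ _ (I.mul_mem_left _ _ ih))))
    obtain ⟨c, rfl⟩ := hx x
    have : ∃ S, c S ≠ 0 := by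
      by_contra! h
      exact hx2 (by simp [h])
    obtain ⟨S, hS⟩ := this
    have h1 := hP S
    rw [cP_sum hk ha0 ha hc] at h1
    have h2 := hsm (c S)⁻¹ _ h1
    rw [smul_smul, inv_mul_cancel₀ hS, one_smul] at h2
    obtain ⟨u, hu⟩ := isUnit_mono ha0 ha S
    have h3 := I.mul_mem_left (↑u⁻¹) _ h2
    rwa [← hu, Units.inv_mul] at h3
  · rw [Module.finrank_eq_card_basis b]; simp

end Aux

/-- Let `F` be a field of characteristic `0`, `V` an `F`-vector space of finite even
dimension `k`, and `Q` a nondegenerate quadratic form on `V` (i.e. the associated symmetric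
bilinear form `B_Q = polar Q / 2`, determined by `Q v = B_Q v v`, is nondegenerate; in
characteristic `0` this is equivalent to nondegeneracy of `polar Q`).  Then the Clifford
algebra `C(Q)` is a central simple `F`-algebra and every simple `C(Q)`-module `L` satisfies
`dim_F L ≥ 2 ^ (k / 2)`. -/
theorem cliffordAlgebra_even_central_simple_and_dim_simple_module
    (F V : Type*) [Field F] [CharZero F] [AddCommGroup V] [Module F V]
    [FiniteDimensional F V] (k : ℕ) (hk : Module.finrank F V = k) (hke : Even k)
    (Q : QuadraticForm F V)
    (hQnd : ∀ u : V, (∀ w : V, QuadraticMap.polar Q u w = 0) → u = 0) :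
    (Subalgebra.center F (CliffordAlgebra Q) = ⊥ ∧ IsSimpleRing (CliffordAlgebra Q)) ∧
    ∀ (L : Type) [AddCommGroup L] [Module (CliffordAlgebra Q) L] [Module F L]
      [IsScalarTower F (CliffordAlgebra Q) L],
      IsSimpleModule (CliffordAlgebra Q) L → 2 ^ (k / 2) ≤ Module.finrank F L := by
  subst hk
  haveI : Invertible (2 : F) := invertibleOfNonzero two_ne_zero
  obtain ⟨v, hv⟩ := LinearMap.BilinForm.exists_orthogonal_basis
    (B := QuadraticMap.associated (R := F) Q) ⟨QuadraticMap.associated_isSymm F Q⟩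
  have hpol : ∀ i j, i ≠ j → QuadraticMap.polar Q (v i) (v j) = 0 := by
    intro i j hij
    have h := hv hij
    have h2 := QuadraticMap.two_nsmul_associated F Q
    have h3 := congrArg (fun B => B (v i) (v j)) h2
    simp only [LinearMap.smul_apply] at h3
    have h4 : (QuadraticMap.associated (R := F) Q) (v i) (v j) = 0 := h
    rw [h4] at h3
    simpa using h3.symm
  have ha0 : ∀ i, Q (v i) ≠ 0 := by
    intro i h0
    apply v.ne_zero i
    apply hQnd
    have : QuadraticMap.polarBilin Q (v i) = 0 := by
      apply v.ext
      intro j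
      by_cases hij : i = j
      · subst hij; simp [QuadraticMap.polar_self, h0]
      · simpa using hpol i j hij
    intro w
    simpa using congrArg (fun f => f w) this
  have ha : ∀ i, CliffordAlgebra.ι Q (v i) * CliffordAlgebra.ι Q (v i) =
      algebraMap F _ (Q (v i)) := fun i => CliffordAlgebra.ι_sq_scalar Q _
  have hc : ∀ i j, i ≠ j → CliffordAlgebra.ι Q (v i) * CliffordAlgebra.ι Q (v j) =
      - (CliffordAlgebra.ι Q (v j) * CliffordAlgebra.ι Q (v i)) := by
    intro i j hij
    rw [CliffordAlgebra.ι_mul_ι_comm, hpol i j hij]; simp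
  have hs : Submodule.span F (Set.range (cMono fun i => CliffordAlgebra.ι Q (v i))) = ⊤ := by
    rw [eq_top_iff]
    rintro x -
    induction x using CliffordAlgebra.left_induction with
    | algebraMap r =>
      rw [Algebra.algebraMap_eq_smul_one]
      exact Submodule.smul_mem _ _ (Submodule.subset_span ⟨∅, by simp [cMono]⟩)
    | add x y hx hy => exact Submodule.add_mem _ hx hy
    | ι_mul x m hx =>
      rw [← v.sum_repr m, map_sum, Finset.sum_mul]
      refine Submodule.sum_mem _ fun i _ => ?_
      rw [map_smul, smul_mul_assoc]
      refine Submodule.smul_mem _ _ ?_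
      induction hx using Submodule.span_induction with
      | mem x h =>
        obtain ⟨S, rfl⟩ := h
        exact e_mul_mono_mem (e := fun i => CliffordAlgebra.ι Q (v i)) ha hc i S
      | zero => simp
      | add x y _ _ hx hy => rw [mul_add]; exact Submodule.add_mem _ hx hy
      | smul r x _ hx => rw [mul_smul_comm]; exact Submodule.smul_mem _ _ hx
  obtain ⟨h1, h2, h3, h4⟩ := cliff_main hke ha0 ha hc hs
  refine ⟨⟨h1, h2⟩, ?_⟩
  intro L _ _ _ _ hL
  haveI : Module.Finite F L := Module.Finite.trans (CliffordAlgebra Q) L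
  haveI : Nontrivial L := IsSimpleModule.nontrivial (CliffordAlgebra Q) L
  haveI : SMulCommClass (CliffordAlgebra Q) F L := IsScalarTower.to_smulCommClass'
  have hinj : Function.Injective (Algebra.lsmul F F L : CliffordAlgebra Q →ₐ[F] Module.End F L) :=
    RingHom.injective (Algebra.lsmul F F L : CliffordAlgebra Q →ₐ[F] Module.End F L).toRingHom
  have h5 := LinearMap.finrank_le_finrank_of_injective
    (f := (Algebra.lsmul F F L : CliffordAlgebra Q →ₐ[F] Module.End F L).toLinearMap) hinj
  rw [h3, Module.finrank_linearMap] at h5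
  obtain ⟨m, hm⟩ := hke
  rw [hm] at h5 ⊢
  rw [pow_add] at h5
  have : (m + m) / 2 = m := by omega
  rw [this]
  exact Nat.mul_self_le_mul_self_iff.1 h5
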